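/- arXiv:1205.6066 — 2 statements merged into one kernel-verified Lean document; each statement's English description precedes it below -/
import Mathlib

section
/- Assume that U preserves filtered colimits and that for every object A of 𝒞, every x ∈ S and every p ∈ ℤ, the image under U of the coproduct inclusion A ⟶ F(K_x[p]) ⨿ A is a quasi-isomorphism in every component. Let N ∈ dg^S consist of free modules with zero differential and let M = Cone(1_{N[−1]}), the componentwise mapping cone of the identity of N[−1]. Then for every chain map α : M ⟶ U A, the morphism (U j̄)(x) is a quasi-isomorphism for every x ∈ S, where j̄ : A ⟶ A⟨M,α⟩. -/
open CategoryTheory CategoryTheory.Limits CochainComplex CochainComplex.HomComplex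

noncomputable section

universe u

/-- The category `dg^S` of `S`-indexed families of cochain complexes of `k`-modules. -/
abbrev DGS (k : Type u) [CommRing k] (S : Type u) : Type _ :=
  S → CochainComplex (ModuleCat.{u} k) ℤ

variable {k : Type u} [CommRing k] {S : Type u}

namespace DGS

/-- The componentwise mapping cone of a morphism of `DGS k S`. -/
def coneFun {M N : DGS k S} (α : M ⟶ N) : DGS k S :=
  fun x => CochainComplex.mappingCone (α x)

/-- The inclusion of the second summand into the componentwise mapping cone. -/
def coneInr {M N : DGS k S} (α : M ⟶ N) : N ⟶ coneFun α :=
  fun x => CochainComplex.mappingCone.inr (α x)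

/-- Componentwise shift. -/
def shift (M : DGS k S) (a : ℤ) : DGS k S := fun x => (M x)⟦a⟧

/-- The componentwise mapping cone of the identity. -/
def coneId (N : DGS k S) : DGS k S := coneFun (𝟙 N)

/-- The inclusion of the second summand in the cone of the identity. -/
def coneIdInr (N : DGS k S) : N ⟶ coneId N := coneInr (𝟙 N)


/-- The zero morphism in `DGS k S` (componentwise zero chain map). -/
def zeroHom (M N : DGS k S) : M ⟶ N := fun _ => 0

/-- `M : DGS k S` consists of free modules with zero differential. -/
def IsFree (M : DGS k S) : Prop :=
  (∀ (x : S) (n m : ℤ), (M x).d n m = 0) ∧ ∀ (x : S) (n : ℤ), Module.Free k ((M x).X n)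

/-- A family `t` of degree `-1` maps `M ⟶ B` satisfies `t d + d t = β` (componentwise). -/
def IsNullHomotopy {M B : DGS k S} (β : M ⟶ B)
    (t : ∀ x : S, Cochain (M x) (B x) (-1)) : Prop :=
  ∀ x : S, δ (-1) 0 (t x) = Cochain.ofHom (β x)

end DGS

variable {𝒞 : Type (u + 1)} [Category.{u} 𝒞] [HasLimits 𝒞] [HasColimits 𝒞]
  (F : DGS k S ⥤ 𝒞) (U : 𝒞 ⥤ DGS k S) (adj : F ⊣ U)

/-- The degree `-1` family of maps `θ : M → U(A⟨M,α⟩)`. -/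
def theta {M : DGS k S} {A : 𝒞} (α : M ⟶ U.obj A) {D : 𝒞}
    (g : F.obj (DGS.coneFun α) ⟶ D) (x : S) : Cochain (M x) ((U.obj D) x) (-1) :=
  (mappingCone.inl (α x)).comp
    (Cochain.ofHom ((adj.unit.app (DGS.coneFun α) ≫ U.map g) x)) (add_zero (-1))

/-- The complex `k` concentrated in degree `0`. -/
def unitComplex (k : Type u) [CommRing k] : CochainComplex (ModuleCat.{u} k) ℤ :=
  (HomologicalComplex.single (ModuleCat.{u} k) (ComplexShape.up ℤ) 0).obj (ModuleCat.of k k)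

/-- The object `K_x` of `DGS k S`: the cone of the identity of `k` in the component `x`,
and `0` elsewhere. -/
def Kx [DecidableEq S] (x : S) : DGS k S :=
  fun y => if y = x then CochainComplex.mappingCone (𝟙 (unitComplex k))
    else (HomologicalComplex.single (ModuleCat.{u} k) (ComplexShape.up ℤ) 0).obj
      (ModuleCat.of k PUnit)

/-- `f` is a weak equivalence: `U f` is a componentwise quasi-isomorphism. -/
def IsWeakEq {X Y : 𝒞} (f : X ⟶ Y) : Prop :=
  ∀ x : S, QuasiIso ((U.map f) x)

/-- `f` is a fibration: `U f` is surjective in every degree, in every component. -/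
def IsFib {X Y : 𝒞} (f : X ⟶ Y) : Prop :=
  ∀ (x : S) (n : ℤ), Function.Surjective (((U.map f) x).f n)

/-- `f` is a cofibration: it has the left lifting property with respect to all
trivial fibrations. -/
def IsCof {X Y : 𝒞} (f : X ⟶ Y) : Prop :=
  ∀ ⦃P Q : 𝒞⦄ (y : P ⟶ Q), IsFib U y → IsWeakEq U y → HasLiftingProperty f y



section partA
variable {R : Type u} [CommRing R] {J : Type u} [SmallCategory J]

lemma quasiIso_functor {S T : ShortComplex (J ⥤ ModuleCat.{u} R)} (φ : S ⟶ T)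
    (h : ∀ j, ShortComplex.QuasiIso (((evaluation J (ModuleCat.{u} R)).obj j).mapShortComplex.map φ)) :
    ShortComplex.QuasiIso φ := by
  rw [ShortComplex.quasiIso_iff]
  rw [NatTrans.isIso_iff_isIso_app]
  intro j
  have h1 := h j
  rw [ShortComplex.quasiIso_iff] at h1
  exact (NatIso.isIso_map_iff (ShortComplex.homologyFunctorIso
    ((evaluation J (ModuleCat.{u} R)).obj j)) φ).1 h1

lemma quasiIso_sc_colim [IsFiltered J] {G H : J ⥤ ShortComplex (ModuleCat.{u} R)} (c : Cocone G) (d : Cocone H)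
    (hc1 : IsColimit (ShortComplex.π₁.mapCocone c)) (hc2 : IsColimit (ShortComplex.π₂.mapCocone c))
    (hc3 : IsColimit (ShortComplex.π₃.mapCocone c))
    (hd1 : IsColimit (ShortComplex.π₁.mapCocone d)) (hd2 : IsColimit (ShortComplex.π₂.mapCocone d))
    (hd3 : IsColimit (ShortComplex.π₃.mapCocone d))
    (τ : G ⟶ H) (hτ : ∀ j, ShortComplex.QuasiIso (τ.app j)) (φ : c.pt ⟶ d.pt)
    (hφ : ∀ j, c.ι.app j ≫ φ = τ.app j ≫ d.ι.app j) : ShortComplex.QuasiIso φ := by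
  let Φ := (ShortComplex.FunctorEquivalence.inverse J (ModuleCat.{u} R)).map τ
  have : ShortComplex.QuasiIso Φ := by
    apply quasiIso_functor
    intro j
    have := hτ j
    exact this
  have h2 : ShortComplex.QuasiIso ((colim (J := J) (C := ModuleCat.{u} R)).mapShortComplex.map Φ) :=
    inferInstanceAs (ShortComplex.QuasiIso ((colim (J := J) (C := ModuleCat.{u} R)).mapShortComplex.map Φ))
  have key : ∀ j, (c.ι.app j).τ₁ ≫ φ.τ₁ = (τ.app j).τ₁ ≫ (d.ι.app j).τ₁ ∧ 
    (c.ι.app j).τ₂ ≫ φ.τ₂ = (τ.app j).τ₂ ≫ (d.ι.app j).τ₂ ∧ (c.ι.app j).τ₃ ≫ φ.τ₃ = (τ.app j).τ₃ ≫ (d.ι.app j).τ₃ := by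
    intro j
    rw [← ShortComplex.comp_τ₁, ← ShortComplex.comp_τ₂, ← ShortComplex.comp_τ₃, hφ]
    exact ⟨rfl, rfl, rfl⟩
  have iso : ∀ {G : J ⥤ ShortComplex (ModuleCat.{u} R)} (c : Cocone G) 
    (hc1 : IsColimit (ShortComplex.π₁.mapCocone c)) (hc2 : IsColimit (ShortComplex.π₂.mapCocone c))
    (hc3 : IsColimit (ShortComplex.π₃.mapCocone c)), ∃ e : (colim (J := J) (C := ModuleCat.{u} R)).mapShortComplex.obj ((ShortComplex.FunctorEquivalence.inverse J (ModuleCat.{u} R)).obj G) ≅ c.pt,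
      (∀ j, colimit.ι (G ⋙ ShortComplex.π₁) j ≫ e.hom.τ₁ = (c.ι.app j).τ₁) ∧ 
      (∀ j, colimit.ι (G ⋙ ShortComplex.π₂) j ≫ e.hom.τ₂ = (c.ι.app j).τ₂) ∧ 
      (∀ j, colimit.ι (G ⋙ ShortComplex.π₃) j ≫ e.hom.τ₃ = (c.ι.app j).τ₃) := by
    intro G c hc1 hc2 hc3
    have e1 := fun j => colimit.isoColimitCocone_ι_hom ⟨_, hc1⟩ j
    have e2 := fun j => colimit.isoColimitCocone_ι_hom ⟨_, hc2⟩ j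
    have e3 := fun j => colimit.isoColimitCocone_ι_hom ⟨_, hc3⟩ j
    refine ⟨ShortComplex.isoMk (colimit.isoColimitCocone ⟨_, hc1⟩) (colimit.isoColimitCocone ⟨_, hc2⟩) 
      (colimit.isoColimitCocone ⟨_, hc3⟩) ?_ ?_, e1, e2, e3⟩
    · apply colimit.hom_ext (F := G ⋙ ShortComplex.π₁)
      intro j
      have h1 := (c.ι.app j).comm₁₂
      erw [reassoc_of% e1 j, ι_colimMap_assoc, e2 j]
      exact h1
    · apply colimit.hom_ext (F := G ⋙ ShortComplex.π₂)
      intro j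
      have h1 := (c.ι.app j).comm₂₃
      erw [reassoc_of% e2 j, ι_colimMap_assoc, e3 j]
      exact h1
  obtain ⟨ec, c1, c2, c3⟩ := iso c hc1 hc2 hc3
  obtain ⟨ed, d1, d2, d3⟩ := iso d hd1 hd2 hd3
  have comm : ec.hom ≫ φ = (colim (J := J) (C := ModuleCat.{u} R)).mapShortComplex.map Φ ≫ ed.hom := by
    ext1
    · apply colimit.hom_ext (F := G ⋙ ShortComplex.π₁)
      intro j
      rw [ShortComplex.comp_τ₁, ShortComplex.comp_τ₁]
      erw [reassoc_of% c1 j, (key j).1, ι_colimMap_assoc, d1]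
      rfl
    · apply colimit.hom_ext (F := G ⋙ ShortComplex.π₂)
      intro j
      rw [ShortComplex.comp_τ₂, ShortComplex.comp_τ₂]
      erw [reassoc_of% c2 j, (key j).2.1, ι_colimMap_assoc, d2]
      rfl
    · apply colimit.hom_ext (F := G ⋙ ShortComplex.π₃)
      intro j
      rw [ShortComplex.comp_τ₃, ShortComplex.comp_τ₃]
      erw [reassoc_of% c3 j, (key j).2.2, ι_colimMap_assoc, d3]
      rfl
  exact (ShortComplex.quasiIso_iff_of_arrow_mk_iso _ _ (Arrow.isoMk ec ed comm)).1 h2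

lemma quasiIso_colim [IsFiltered J] {G H : J ⥤ CochainComplex (ModuleCat.{u} R) ℤ} (c : Cocone G) (d : Cocone H)
    (hc : IsColimit c) (hd : IsColimit d)
    (τ : G ⟶ H) (hτ : ∀ j, QuasiIso (τ.app j)) (φ : c.pt ⟶ d.pt)
    (hφ : ∀ j, c.ι.app j ≫ φ = τ.app j ≫ d.ι.app j) : QuasiIso φ := by
  rw [quasiIso_iff]
  intro n
  rw [quasiIsoAt_iff]
  have hc' := fun n => isColimitOfPreserves (HomologicalComplex.eval (ModuleCat.{u} R) (ComplexShape.up ℤ) n) hc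
  have hd' := fun n => isColimitOfPreserves (HomologicalComplex.eval (ModuleCat.{u} R) (ComplexShape.up ℤ) n) hd
  refine quasiIso_sc_colim ((HomologicalComplex.shortComplexFunctor _ _ n).mapCocone c) ((HomologicalComplex.shortComplexFunctor _ _ n).mapCocone d)
    (hc' _) (hc' _) (hc' _) (hd' _) (hd' _) (hd' _) (Functor.whiskerRight τ _) ?_ _ ?_
  · intro j
    have := hτ j
    rw [quasiIso_iff] at this
    exact (quasiIsoAt_iff _ _).1 (this n)
  · intro j
    let Q := HomologicalComplex.shortComplexFunctor (ModuleCat.{u} R) (ComplexShape.up ℤ) n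
    exact ((Q.map_comp _ _).symm.trans (congrArg Q.map (hφ j))).trans (Q.map_comp _ _)

def isColimitEvalPi {S : Type u} {G : J ⥤ (S → CochainComplex (ModuleCat.{u} R) ℤ)} (c : Cocone G) (hc : IsColimit c) (x : S) :
    IsColimit (pi.coconeCompEval c x) := by
  let c' := fun x => colimit.cocone (G ⋙ Pi.eval (fun _ : S => CochainComplex (ModuleCat.{u} R) ℤ) x)
  let e := hc.coconePointUniqueUpToIso (pi.coconeOfCoconeEvalIsColimit (c := c') (fun x => colimit.isColimit _))
  have he := fun j => hc.comp_coconePointUniqueUpToIso_inv (pi.coconeOfCoconeEvalIsColimit (c := c') (fun x => colimit.isColimit _)) j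
  exact (colimit.isColimit _).ofIsoColimit (Cocone.ext ((Pi.eval _ x).mapIso e.symm) (fun j => congrFun (he j) x))
end partA

section partB
attribute [local simp] coprod.inl_desc coprod.inr_desc coprod.inl_desc_assoc coprod.inr_desc_assoc
  Sigma.ι_desc Sigma.ι_desc_assoc coprod.inl_map coprod.inr_map coprod.inl_map_assoc coprod.inr_map_assoc
variable {C : Type (u+1)} [Category.{u} C] [HasColimits C] {I : Type u} (X : I → C)

/-- `D` is the coproduct of `A` and the `X i`, `i ∈ s`. -/
def UnivCop (s : Finset I) {A D : C} (j : A ⟶ D) (m : ∀ i, i ∈ s → (X i ⟶ D)) : Prop :=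
  ∀ (B : C) (f : A ⟶ B) (n : ∀ i, i ∈ s → (X i ⟶ B)),
    ∃! h : D ⟶ B, j ≫ h = f ∧ ∀ i hi, m i hi ≫ h = n i hi

variable {X}

lemma UnivCop.hom_ext {s : Finset I} {A D : C} {j : A ⟶ D} {m : ∀ i, i ∈ s → (X i ⟶ D)}
    (h : UnivCop X s j m) {B : C} {f g : D ⟶ B} (h1 : j ≫ f = j ≫ g)
    (h2 : ∀ i hi, m i hi ≫ f = m i hi ≫ g) : f = g :=
  (h B (j ≫ g) (fun i hi => m i hi ≫ g)).unique ⟨h1, h2⟩ ⟨rfl, fun _ _ => rfl⟩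

lemma UnivCop.unique {s : Finset I} {A D D' : C} {j : A ⟶ D} {m : ∀ i, i ∈ s → (X i ⟶ D)}
    (h : UnivCop X s j m) {j' : A ⟶ D'} {m' : ∀ i, i ∈ s → (X i ⟶ D')}
    (h' : UnivCop X s j' m') : ∃ e : D ≅ D', j ≫ e.hom = j' := by
  obtain ⟨a, ⟨ha1, ha2⟩, -⟩ := h D' j' m'
  obtain ⟨b, ⟨hb1, hb2⟩, -⟩ := h' D j m
  refine ⟨⟨a, b, h.hom_ext ?_ ?_, h'.hom_ext ?_ ?_⟩, ha1⟩
  · rw [← Category.assoc, ha1, hb1, Category.comp_id]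
  · intro i hi
    rw [← Category.assoc, ha2, hb2, Category.comp_id]
  · rw [← Category.assoc, hb1, ha1, Category.comp_id]
  · intro i hi
    rw [← Category.assoc, hb2, ha2, Category.comp_id]

variable (W : MorphismProperty C) [W.IsMultiplicative] [W.RespectsIso]

lemma exists_univCop (hX : ∀ (A : C) (i : I), W (coprod.inr : A ⟶ X i ⨿ A)) (A : C)
    (s : Finset I) : ∃ (D : C) (j : A ⟶ D) (m : ∀ i, i ∈ s → (X i ⟶ D)),
      UnivCop X s j m ∧ W j := by
  classical
  induction s using Finset.induction_on with
  | empty =>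
    refine ⟨A, 𝟙 A, fun i hi => absurd hi (Finset.notMem_empty i), ?_, W.id_mem A⟩
    intro B f n
    refine ⟨f, ⟨by simp, fun i hi => absurd hi (Finset.notMem_empty i)⟩, ?_⟩
    rintro g ⟨hg, -⟩
    simpa using hg
  | insert a s ha ih =>
    obtain ⟨D, j, m, h, hj⟩ := ih
    refine ⟨X a ⨿ D, j ≫ coprod.inr, fun i hi => if e : i = a then eqToHom (by rw [e]) ≫ coprod.inl
      else m i (Finset.mem_of_mem_insert_of_ne hi e) ≫ coprod.inr, ?_,
      W.comp_mem _ _ hj (hX D a)⟩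
    intro B f n
    obtain ⟨g, ⟨hg1, hg2⟩, -⟩ := h B f (fun i hi => n i (Finset.mem_insert_of_mem hi))
    refine ⟨coprod.desc (n a (Finset.mem_insert_self a s)) g, ⟨by simp [hg1], ?_⟩, ?_⟩
    · intro i hi
      by_cases e : i = a
      · subst e
        simp
      · simp [e, hg2]
    · rintro g' ⟨h1, h2⟩
      apply coprod.hom_ext
      · simpa using h2 a (Finset.mem_insert_self a s)
      · apply h.hom_ext
        · rw [← Category.assoc, h1]; simp [hg1]
        · intro i hi
          have e : i ≠ a := fun e => ha (e ▸ hi)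
          have := h2 i (Finset.mem_insert_of_mem hi)
          simp only [e, dite_false, Category.assoc] at this
          rw [this]
          simp [hg2]

lemma univCop_coprod (A : C) (s : Finset I) : UnivCop X s
    (coprod.inr : A ⟶ (∐ fun i : s => X i) ⨿ A)
    (fun i hi => Sigma.ι (fun i : s => X i) ⟨i, hi⟩ ≫ coprod.inl) := by
  intro B f n
  refine ⟨coprod.desc (Sigma.desc fun i => n i.1 i.2) f, ⟨by simp, by simp⟩, ?_⟩
  rintro g ⟨h1, h2⟩
  apply coprod.hom_ext
  · apply Sigma.hom_ext
    rintro ⟨i, hi⟩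
    simpa using h2 i hi
  · simpa using h1

variable (X) in
/-- The diagram of finite partial coproducts. -/
def finDiag (A : C) : Finset I ⥤ C where
  obj s := (∐ fun i : s => X i) ⨿ A
  map {s t} h := coprod.map (Sigma.desc fun i : s => Sigma.ι (fun i : t => X i) ⟨i.1, leOfHom h i.2⟩) (𝟙 A)
  map_id s := by
    apply coprod.hom_ext
    · apply Sigma.hom_ext
      rintro ⟨i, hi⟩
      simp
    · simp
  map_comp {s t r} h h' := by
    apply coprod.hom_ext
    · apply Sigma.hom_ext
      rintro ⟨i, hi⟩
      simp
    · simp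

lemma univ_W (hX : ∀ (A : C) (i : I), W (coprod.inr : A ⟶ X i ⨿ A))
    [W.IsStableUnderColimitsOfShape (Finset I)]
    {A D : C} (j : A ⟶ D) (m : ∀ i, X i ⟶ D)
    (hD : ∀ (B : C) (f : A ⟶ B) (n : ∀ i, X i ⟶ B), 
      ∃! h : D ⟶ B, j ≫ h = f ∧ ∀ i, m i ≫ h = n i) : W j := by
  classical
  let T := finDiag X A
  let c : Cocone T :=
    { pt := D
      ι := { app := fun s => coprod.desc (Sigma.desc fun i => m i) j
             naturality := by
              intro s t h
              apply coprod.hom_ext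
              · apply Sigma.hom_ext
                rintro ⟨i, hi⟩
                simp [T, finDiag]
              · simp [T, finDiag] } }
  have cj : ∀ s, coprod.inr ≫ c.ι.app s = j := fun s => coprod.inr_desc _ _
  have cm : ∀ (s : Finset I) (i : s), Sigma.ι (fun i : s => X i) i ≫ coprod.inl ≫ c.ι.app s = m i := by
    intro s i
    simp [c]
  have hc : IsColimit c := by
    apply IsColimit.ofExistsUnique
    intro s
    have wr : ∀ t, coprod.inr ≫ s.ι.app t = coprod.inr ≫ s.ι.app (∅ : Finset I) := by
      intro t
      rw [← s.w (homOfLE (Finset.empty_subset t))]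
      simp [T, finDiag]
    have wl : ∀ (t : Finset I) (i : I) (hi : i ∈ t), Sigma.ι (fun i : t => X i) ⟨i, hi⟩ ≫ coprod.inl ≫ s.ι.app t =
        Sigma.ι (fun i : ({i} : Finset I) => X i) ⟨i, Finset.mem_singleton_self i⟩ ≫ coprod.inl ≫ s.ι.app {i} := by
      intro t i hi
      rw [← s.w (homOfLE (show ({i} : Finset I) ≤ t from Finset.singleton_subset_iff.2 hi))]
      simp [T, finDiag]
    obtain ⟨g, ⟨h1, h2⟩, hu⟩ := hD s.pt (coprod.inr ≫ s.ι.app (∅ : Finset I)) (fun i => 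
      Sigma.ι (fun i : ({i} : Finset I) => X i) ⟨i, Finset.mem_singleton_self i⟩ ≫ coprod.inl ≫ s.ι.app {i})
    refine ⟨g, ?_, ?_⟩
    · intro t
      apply coprod.hom_ext
      · apply Sigma.hom_ext
        rintro ⟨i, hi⟩
        refine Eq.trans ?_ (wl t i hi).symm
        rw [← h2 i, ← cm t ⟨i, hi⟩]
        erw [Category.assoc, Category.assoc]
        rfl
      · refine Eq.trans ?_ (wr t).symm
        rw [← h1, ← cj t]
        erw [Category.assoc]
        rfl
    · intro g' hg'
      apply hu
      constructor
      · rw [← cj ∅]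
        erw [Category.assoc, hg']
      · intro i
        rw [← cm {i} ⟨i, Finset.mem_singleton_self i⟩]
        erw [Category.assoc, Category.assoc, hg']
  have hW : ∀ s : Finset I, W (coprod.inr : A ⟶ (∐ fun i : s => X i) ⨿ A) := by
    intro s
    obtain ⟨D', j', m', h, hj⟩ := exists_univCop W hX A s
    obtain ⟨e, he⟩ := h.unique (univCop_coprod A s)
    rw [← he]
    exact (W.cancel_right_of_respectsIso _ _).2 hj
  let τ : (Functor.const (Finset I)).obj A ⟶ T :=
    { app := fun s => coprod.inr
      naturality := by intro s t h; simp [T, finDiag] }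
  have : IsConnected (Finset I) := inferInstance
  exact MorphismProperty.IsStableUnderColimitsOfShape.condition (W := W) (J := Finset I) _ T _ c
    (isColimitConstCocone (Finset I) A) hc τ hW j (fun s => by
      exact (Category.id_comp j).trans (cj s).symm)

end partB

section partC

lemma cone_desc {L G Y : CochainComplex (ModuleCat.{u} k) ℤ} (a : mappingCone (𝟙 L) ⟶ G) (β : G ⟶ Y)
    (t : Cochain L Y (-2)) : ∃! h : mappingCone a ⟶ Y, mappingCone.inr a ≫ h = β ∧
      (mappingCone.inl (𝟙 L)).comp ((mappingCone.inl a).comp (Cochain.ofHom h) (add_zero (-1)))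
        (show -1 + -1 = -2 by norm_num) = t := by
  let t2 : Cochain L Y (-1) := (mappingCone.inl (𝟙 L)).comp (Cochain.ofHom (a ≫ β)) (add_zero (-1)) - δ (-2) (-1) t
  have h0 : δ (-1) 0 (mappingCone.descCochain (𝟙 L) t t2 (by norm_num)) = Cochain.ofHom (a ≫ β) := by
    rw [mappingCone.δ_descCochain (n' := 0) (hn' := by norm_num),
      mappingCone.ext_cochain_from_iff (𝟙 L) (-1) 0 (by norm_num)]
    constructor
    · simp [t2]
    · simp only [Cochain.comp_add, mappingCone.inr_fst_assoc, mappingCone.inr_snd_assoc, zero_add, t2, δ_sub, δ_δ, sub_zero]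
      rw [δ_comp_zero_cochain _ _ 0 (by norm_num)]
      simp
  refine ⟨mappingCone.desc a _ β h0, ⟨by simp, by simp⟩, ?_⟩
  rintro g ⟨h1, h2⟩
  have e1 : δ (-1) 0 ((mappingCone.inl a).comp (Cochain.ofHom g) (add_zero (-1))) = Cochain.ofHom (a ≫ β) := by
    rw [δ_comp_zero_cochain _ _ 0 (by norm_num), ← h1]
    simp
  have e2 : (mappingCone.inl a).comp (Cochain.ofHom g) (add_zero (-1)) = mappingCone.descCochain (𝟙 L) t t2 (by norm_num) := by
    generalize (mappingCone.inl a).comp (Cochain.ofHom g) (add_zero (-1)) = s at e1 h2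
    rw [mappingCone.ext_cochain_from_iff (𝟙 L) (-2) (-1) (by norm_num)]
    refine ⟨by rw [h2]; simp, ?_⟩
    rw [mappingCone.inr_descCochain]
    simp only [t2]
    rw [← h2, ← e1, δ_comp _ _ (show -1 + -1 = -2 by norm_num) 0 0 (-1) (by norm_num) (by norm_num) (by norm_num)]
    simp
  have e3 : Cochain.ofHom g = Cochain.ofHom (mappingCone.desc a _ β h0) := by
    rw [mappingCone.ext_cochain_from_iff a (-1) 0 (by norm_num)]
    constructor
    · rw [e2]; simp
    · rw [← Cochain.ofHom_comp, h1]; simp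
  exact Cochain.ofHom_injective e3

/-- `X` corepresents evaluation in component `x` and degree `m`. -/
def CorepC (X : CochainComplex (ModuleCat.{u} k) ℤ) (m : ℤ) : Prop :=
  ∃ e : ∀ Y : CochainComplex (ModuleCat.{u} k) ℤ, (X ⟶ Y) ≃ Y.X m, ∀ Y Z (h : X ⟶ Y) (f : Y ⟶ Z),
    e Z (h ≫ f) = f.f m (e Y h)

lemma corepC_iso {X X' : CochainComplex (ModuleCat.{u} k) ℤ} (i : X ≅ X') {m : ℤ} (h : CorepC X m) : CorepC X' m := by
  obtain ⟨e, he⟩ := h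
  refine ⟨fun Y => (i.homFromEquiv (Z := Y)).symm.trans (e Y), fun Y Z h f => ?_⟩
  simp [he]

lemma corepC_shift {X : CochainComplex (ModuleCat.{u} k) ℤ} {m : ℤ} (h : CorepC X m) (p : ℤ) :
    CorepC (X⟦p⟧) (m + -p) := by
  obtain ⟨e, he⟩ := h
  let ad := (shiftEquiv (CochainComplex (ModuleCat.{u} k) ℤ) p).toAdjunction
  refine ⟨fun Y => (ad.homEquiv X Y).trans (e _), fun Y Z h f => ?_⟩
  have := ad.homEquiv_naturality_right h f
  exact (congrArg (e _) this).trans (he _ _ _ _)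

/-- Morphisms out of the cone of an identity are cochains of degree `-1`. -/
def coneIdEquiv (E Y : CochainComplex (ModuleCat.{u} k) ℤ) :
    (mappingCone (𝟙 E) ⟶ Y) ≃ Cochain E Y (-1) where
  toFun h := (mappingCone.inl (𝟙 E)).comp (Cochain.ofHom h) (add_zero (-1))
  invFun t := mappingCone.desc (𝟙 E) t
    (Cocycle.homOf (Cocycle.mk (δ (-1) 0 t) 1 (by norm_num) (by rw [δ_δ])))
    (by rw [Category.id_comp, Cocycle.cochain_ofHom_homOf_eq_coe]; rfl)
  left_inv h := by
    apply Cochain.ofHom_injective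
    rw [mappingCone.ext_cochain_from_iff (𝟙 E) (-1) 0 (by norm_num)]
    constructor
    · simp
    · simp [δ_comp_zero_cochain, Cocycle.cochain_ofHom_homOf_eq_coe]
  right_inv t := by simp

lemma corepC_cone : CorepC (mappingCone (𝟙 (unitComplex k))) (-1) := by
  let E3 : ∀ Y : CochainComplex (ModuleCat.{u} k) ℤ, (ModuleCat.of k k ⟶ Y.X (-1)) ≃ Y.X (-1) :=
    fun Y => ModuleCat.homEquiv.trans (LinearMap.ringLmapEquivSelf k k (Y.X (-1))).toEquiv
  let e : ∀ Y : CochainComplex (ModuleCat.{u} k) ℤ, (mappingCone (𝟙 (unitComplex k)) ⟶ Y) ≃ Y.X (-1) :=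
    fun Y => ((coneIdEquiv (unitComplex k) Y).trans
      (Cochain.fromSingleEquiv (X := ModuleCat.of k k) (p := 0) (q := -1) (n := -1)
        (by norm_num)).toEquiv).trans (E3 Y)
  refine ⟨e, fun Y Z h f => ?_⟩
  have he : ∀ (Y : CochainComplex (ModuleCat.{u} k) ℤ) (h : mappingCone (𝟙 (unitComplex k)) ⟶ Y), e Y h =
      ((HomologicalComplex.singleObjXSelf (ComplexShape.up ℤ) 0 (ModuleCat.of k k)).inv ≫
        ((mappingCone.inl (𝟙 (unitComplex k))).comp (Cochain.ofHom h) (add_zero (-1))).v 0 (-1)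
          (by norm_num)).hom (1 : k) := fun Y h => rfl
  rw [he, he, Cochain.comp_zero_cochain_v, Cochain.comp_zero_cochain_v, Cochain.ofHom_v, Cochain.ofHom_v]
  rfl

/-- `X` corepresents evaluation in component `x` and degree `m`. -/
def Corep (X : DGS k S) (x : S) (m : ℤ) : Prop :=
  ∃ e : ∀ Y : DGS k S, (X ⟶ Y) ≃ (Y x).X m, ∀ Y Z (h : X ⟶ Y) (f : Y ⟶ Z),
    e Z (h ≫ f) = (f x).f m (e Y h)

lemma corep_of {X : DGS k S} {x : S} {m : ℤ} (h : CorepC (X x) m) (hz : ∀ y, y ≠ x → IsZero (X y)) :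
    Corep X x m := by
  classical
  obtain ⟨e, he⟩ := h
  let E : ∀ Y : DGS k S, (X ⟶ Y) ≃ (X x ⟶ Y x) := fun Y =>
    { toFun := fun f => f x
      invFun := fun f y => if h : y = x then eqToHom (by rw [h]) ≫ f ≫ eqToHom (by rw [h]) else (hz y h).to_ _
      left_inv := by
        intro f
        funext y
        by_cases h : y = x
        · subst h
          simp
        · exact (hz y h).eq_of_src _ _
      right_inv := by
        intro f
        simp }
  exact ⟨fun Y => (E Y).trans (e _), fun Y Z h f => he _ _ _ _⟩

lemma corep_Kx [DecidableEq S] (x : S) (p m : ℤ) (hm : m = -1 + -p) :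
    Corep (DGS.shift (Kx (k := k) x) p) x m := by
  subst hm
  apply corep_of
  · apply corepC_shift
    have : Kx (k := k) x x = mappingCone (𝟙 (unitComplex k)) := by simp [Kx]
    rw [this]
    exact corepC_cone
  · intro y hy
    have : Kx (k := k) x y = (HomologicalComplex.single (ModuleCat.{u} k) (ComplexShape.up ℤ) 0).obj
      (ModuleCat.of k PUnit) := by simp [Kx, hy]
    simp only [DGS.shift]
    rw [this]
    apply Functor.map_isZero
    apply Functor.map_isZero
    exact ModuleCat.isZero_of_subsingleton _

end partC

section partD

lemma cochain_ext_basis {L Y : CochainComplex (ModuleCat.{u} k) ℤ} {J : ℤ → Type u}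
    (b : ∀ n, Module.Basis (J n) k (L.X n)) {s t : Cochain L Y (-2)}
    (h : ∀ n j, (s.v n (n + -2) rfl).hom (b n j) = (t.v n (n + -2) rfl).hom (b n j)) : s = t := by
  apply Cochain.ext
  rintro p q rfl
  apply ModuleCat.hom_ext
  exact (b p).ext (h p)

lemma cochain_exists_basis {L Y : CochainComplex (ModuleCat.{u} k) ℤ} {J : ℤ → Type u}
    (b : ∀ n, Module.Basis (J n) k (L.X n)) (v : ∀ n, J n → Y.X (n + -2)) :
    ∃ t : Cochain L Y (-2), ∀ n j, (t.v n (n + -2) rfl).hom (b n j) = v n j := by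
  refine ⟨Cochain.mk (fun p q h => ModuleCat.ofHom ((b p).constr k (v p)) ≫
    (HomologicalComplex.XIsoOfEq Y h).hom), fun n j => ?_⟩
  rw [Cochain.mk_v]
  simp

lemma cone_univ_comp {L G : CochainComplex (ModuleCat.{u} k) ℤ} {J : ℤ → Type u}
    (b : ∀ n, Module.Basis (J n) k (L.X n)) (a : mappingCone (𝟙 L) ⟶ G) :
    ∃ z : ∀ n, J n → (mappingCone a).X (n + -2), ∀ (Y : CochainComplex (ModuleCat.{u} k) ℤ)
      (β : G ⟶ Y) (v : ∀ n, J n → Y.X (n + -2)), ∃! h : mappingCone a ⟶ Y,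
        mappingCone.inr a ≫ h = β ∧ ∀ n j, h.f (n + -2) (z n j) = v n j := by
  let z : Cochain L (mappingCone a) (-2) :=
    (mappingCone.inl (𝟙 L)).comp (mappingCone.inl a) (show -1 + -1 = -2 by norm_num)
  have hz : ∀ (Y : CochainComplex (ModuleCat.{u} k) ℤ) (h : mappingCone a ⟶ Y) (n : ℤ) (y : L.X n),
      (((mappingCone.inl (𝟙 L)).comp ((mappingCone.inl a).comp (Cochain.ofHom h) (add_zero (-1)))
        (show -1 + -1 = -2 by norm_num)).v n (n + -2) rfl).hom y =
      h.f (n + -2) ((z.v n (n + -2) rfl).hom y) := by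
    intro Y h n y
    have : (mappingCone.inl (𝟙 L)).comp ((mappingCone.inl a).comp (Cochain.ofHom h) (add_zero (-1)))
        (show -1 + -1 = -2 by norm_num) = z.comp (Cochain.ofHom h) (add_zero (-2)) := by
      simp only [z]
      rw [Cochain.comp_assoc_of_third_is_zero_cochain]
    rw [this, Cochain.comp_zero_cochain_v, Cochain.ofHom_v]
    rfl
  refine ⟨fun n j => (z.v n (n + -2) rfl).hom (b n j), fun Y β v => ?_⟩
  obtain ⟨t, ht⟩ := cochain_exists_basis b v
  obtain ⟨h, ⟨h1, h2⟩, h3⟩ := cone_desc a β t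
  refine ⟨h, ⟨h1, fun m j => ?_⟩, ?_⟩
  · rw [← hz, h2, ht]
  · rintro h' ⟨h1', h2'⟩
    refine h3 h' ⟨h1', cochain_ext_basis b fun m j => ?_⟩
    rw [ht, hz, h2']

lemma cone_univ [DecidableEq S] (L : DGS k S) (hL : ∀ x n, Module.Free k ((L x).X n)) (G : DGS k S)
    (α : DGS.coneId L ⟶ G) :
    ∃ (I : Type u) (xs : I → S) (ps : I → ℤ)
      (κ : ∀ i, DGS.shift (Kx (k := k) (xs i)) (ps i) ⟶ DGS.coneFun α),
      ∀ (Y : DGS k S) (β : G ⟶ Y) (n : ∀ i, DGS.shift (Kx (k := k) (xs i)) (ps i) ⟶ Y),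
        ∃! h : DGS.coneFun α ⟶ Y, DGS.coneInr α ≫ h = β ∧ ∀ i, κ i ≫ h = n i := by
  let b : ∀ x n, Module.Basis (Module.Free.ChooseBasisIndex k ((L x).X n)) k ((L x).X n) :=
    fun x n => Module.Free.chooseBasis k ((L x).X n)
  let I : Type u := Σ x : S, Σ n : ℤ, Module.Free.ChooseBasisIndex k ((L x).X n)
  have hc : ∀ i : I, Corep (DGS.shift (Kx (k := k) i.1) (1 - i.2.1)) i.1 (i.2.1 + -2) :=
    fun i => corep_Kx _ _ _ (by ring)
  choose e he using hc
  have hzz : ∀ x, ∃ z : ∀ n, Module.Free.ChooseBasisIndex k ((L x).X n) → (DGS.coneFun α x).X (n + -2),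
      ∀ (Y : CochainComplex (ModuleCat.{u} k) ℤ)
      (β : G x ⟶ Y) (v : ∀ n, Module.Free.ChooseBasisIndex k ((L x).X n) → Y.X (n + -2)),
        ∃! h : DGS.coneFun α x ⟶ Y,
        DGS.coneInr α x ≫ h = β ∧ ∀ n j, h.f (n + -2) (z n j) = v n j :=
    fun x => cone_univ_comp (b x) (α x)
  choose z hz using hzz
  let κ : ∀ i : I, DGS.shift (Kx (k := k) i.1) (1 - i.2.1) ⟶ DGS.coneFun α := fun i =>
    (e i _).symm (z i.1 i.2.1 i.2.2)
  have hκ : ∀ (Y : DGS k S) (h : DGS.coneFun α ⟶ Y) (i : I), e i _ (κ i ≫ h) =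
      (h i.1).f (i.2.1 + -2) (z i.1 i.2.1 i.2.2) := by
    intro Y h i
    rw [he]
    simp only [κ]
    rw [Equiv.apply_symm_apply]
  refine ⟨I, fun i => i.1, fun i => 1 - i.2.1, κ, fun Y β n => ?_⟩
  have hx := fun x => hz x (Y x) (β x) (fun m j => e ⟨x, m, j⟩ _ (n ⟨x, m, j⟩))
  choose h hh hu using hx
  refine ⟨h, ⟨funext fun x => (hh x).1, fun i => (e i _).injective ?_⟩, ?_⟩
  · rw [hκ]
    exact (hh i.1).2 i.2.1 i.2.2
  · rintro h' ⟨h1, h2⟩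
    funext x
    refine hu x (h' x) ⟨congrFun h1 x, fun m j => ?_⟩
    rw [← h2 ⟨x, m, j⟩]
    exact (hκ _ _ ⟨x, m, j⟩).symm

lemma jbar_univ [DecidableEq S] (L : DGS k S) (hL : ∀ x n, Module.Free k ((L x).X n)) {A : 𝒞}
    (α : DGS.coneId L ⟶ U.obj A) {D : 𝒞} (jbar : A ⟶ D)
    (g : F.obj (DGS.coneFun α) ⟶ D)
    (hpo : IsPushout (adj.counit.app A) (F.map (DGS.coneInr α)) jbar g) :
    ∃ (I : Type u) (xs : I → S) (ps : I → ℤ)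
      (m : ∀ i, F.obj (DGS.shift (Kx (k := k) (xs i)) (ps i)) ⟶ D),
      ∀ (B : 𝒞) (f : A ⟶ B) (n : ∀ i, F.obj (DGS.shift (Kx (k := k) (xs i)) (ps i)) ⟶ B),
        ∃! h : D ⟶ B, jbar ≫ h = f ∧ ∀ i, m i ≫ h = n i := by
  obtain ⟨I, xs, ps, κ, hκ⟩ := cone_univ L hL (U.obj A) α
  refine ⟨I, xs, ps, fun i => F.map (κ i) ≫ g, fun B f n => ?_⟩
  obtain ⟨h, ⟨h1, h2⟩, h3⟩ := hκ (U.obj B) (U.map f) (fun i => adj.homEquiv _ _ (n i))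
  have w : adj.counit.app A ≫ f = F.map (DGS.coneInr α) ≫ (adj.homEquiv _ _).symm h := by
    rw [← adj.homEquiv_naturality_left_symm, h1]
    simp [Adjunction.homEquiv_counit]
  refine ⟨hpo.desc f ((adj.homEquiv _ _).symm h) w, ⟨hpo.inl_desc _ _ _, fun i => ?_⟩, ?_⟩
  · rw [Category.assoc, hpo.inr_desc, ← adj.homEquiv_naturality_left_symm, h2, Equiv.symm_apply_apply]
  · rintro h' ⟨h1', h2'⟩
    apply hpo.hom_ext
    · rw [h1', hpo.inl_desc]
    · rw [hpo.inr_desc, Equiv.eq_symm_apply]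
      refine h3 _ ⟨?_, fun i => ?_⟩
      · rw [← adj.homEquiv_naturality_left, ← Category.assoc, ← hpo.w, Category.assoc, h1']
        simp [Adjunction.homEquiv_unit]
      · rw [← adj.homEquiv_naturality_left, ← h2', Category.assoc]

end partD

section partE

/-- The class of weak equivalences. -/
def weq : MorphismProperty 𝒞 := fun _ _ f => ∀ x : S, QuasiIso ((U.map f) x)

instance : (weq U).IsMultiplicative where
  id_mem X x := by
    rw [U.map_id]
    exact inferInstanceAs (QuasiIso (𝟙 (U.obj X x)))
  comp_mem f g hf hg x := by
    rw [U.map_comp]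
    have := hf x
    have := hg x
    exact inferInstanceAs (QuasiIso ((U.map f) x ≫ (U.map g) x))

lemma weq_of_isIso {X Y : 𝒞} (f : X ⟶ Y) [IsIso f] : weq U f := by
  intro x
  have : IsIso ((Pi.eval _ x : DGS k S ⥤ _).map (U.map f)) := inferInstance
  have : IsIso ((U.map f) x) := this
  infer_instance

instance : (weq U).RespectsIso :=
  MorphismProperty.RespectsIso.mk _
    (fun e f hf => (weq U).comp_mem _ _ (weq_of_isIso U e.hom) hf)
    (fun e f hf => (weq U).comp_mem _ _ hf (weq_of_isIso U e.hom))

lemma weq_stable {J : Type u} [SmallCategory J] [IsFiltered J] [PreservesFilteredColimits U] :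
    (weq U).IsStableUnderColimitsOfShape J where
  condition G H c d hc hd τ hτ φ hφ x := by
    have hc' := isColimitEvalPi _ (isColimitOfPreserves U hc) x
    have hd' := isColimitEvalPi _ (isColimitOfPreserves U hd) x
    refine quasiIso_colim _ _ hc' hd'
      (Functor.whiskerRight (Functor.whiskerRight τ U) (Pi.eval _ x)) (fun j => hτ j x) ((U.map φ) x) (fun j => ?_)
    have := congrFun (congrArg U.map (hφ j)) x
    rw [U.map_comp, U.map_comp] at this
    exact this

end partE

section
variable [DecidableEq S]

/-- If `U` preserves filtered colimits and `U` of every coproduct inclusion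
`A ⟶ F(K_x[p]) ⨿ A` is a componentwise quasi-isomorphism, then for `N` consisting of
free modules with zero differential and `M = Cone(1_{N[-1]})`, the morphism
`j̄ : A ⟶ A⟨M,α⟩` is a weak equivalence: `U j̄` is a componentwise quasi-isomorphism. -/
theorem jbar_isWeakEq [PreservesFilteredColimits U]
    (hK : ∀ (A : 𝒞) (x : S) (p : ℤ) (y : S),
      QuasiIso ((U.map (coprod.inr : A ⟶ F.obj (DGS.shift (Kx x) p) ⨿ A)) y))
    (N : DGS k S) (hN : DGS.IsFree N)
    {A : 𝒞} (α : DGS.coneId (DGS.shift N (-1)) ⟶ U.obj A) {D : 𝒞} (jbar : A ⟶ D)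
    (g : F.obj (DGS.coneFun α) ⟶ D)
    (hpo : IsPushout (adj.counit.app A) (F.map (DGS.coneInr α)) jbar g) :
    ∀ x : S, QuasiIso ((U.map jbar) x) := by
  classical
  obtain ⟨I, xs, ps, m, hm⟩ := jbar_univ F U adj (DGS.shift N (-1)) (fun x n => hN.2 x (n + -1))
    α jbar g hpo
  have := weq_stable (J := Finset I) U
  exact univ_W (weq U) (fun A i => hK A (xs i) (ps i)) jbar m hm

end
end
end

section
/- Assume that U preserves filtered colimits. For every morphism f : X ⟶ Y of 𝒞 there exist a sequence of objects X = D₀, D₁, D₂, … of 𝒞 and morphisms hₙ : Dₙ ⟶ Dₙ₊₁, each of which is the structure morphism j̄ : Dₙ ⟶ Dₙ⟨Mₙ,αₙ⟩ of a pushout for some Mₙ ∈ dg^S consisting of free modules with zero differential and some chain map αₙ : Mₙ ⟶ U Dₙ, together with morphisms qₙ : Dₙ ⟶ Y with q₀ = f and hₙ ≫ qₙ₊₁ = qₙ for all n, such that the induced morphism q : colimₙ Dₙ ⟶ Y satisfies: for every x ∈ S, (U q)(x) is surjective in every degree and is a quasi-isomorphism. (This is the factorization of f into a standard cofibration followed by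 a trivial fibration.) -/
open CategoryTheory CategoryTheory.Limits CochainComplex CochainComplex.HomComplex

noncomputable section

universe u

variable {k : Type u} [CommRing k] {S : Type u}

variable {𝒞 : Type (u + 1)} [Category.{u} 𝒞] [HasLimits 𝒞] [HasColimits 𝒞]
  (F : DGS k S ⥤ 𝒞) (U : 𝒞 ⥤ DGS k S) (adj : F ⊣ U)

/-- `j : B ⟶ E` is an elementary standard cofibration: it is (the structure morphism of)
a pushout `B ⟶ B⟨M,α⟩` for some `M` consisting of free modules with zero differential. -/
def IsElemStdCof {B E : 𝒞} (j : B ⟶ E) : Prop :=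
  ∃ (M : DGS k S) (α : M ⟶ U.obj B) (g : F.obj (DGS.coneFun α) ⟶ E),
    DGS.IsFree M ∧ IsPushout (adj.counit.app B) (F.map (DGS.coneInr α)) j g

namespace FactAux

/-- Generators in degree `n`: pairs of a cycle `b` and an element `y` with `d y = φ b`. -/
structure Gen {K L : CochainComplex (ModuleCat.{u} k) ℤ} (φ : K ⟶ L) (n : ℤ) : Type u where
  b : K.X n
  y : L.X (n + -1)
  hb : K.d n (n + 1) b = 0
  hy : L.d (n + -1) n y = φ.f n b

/-- The free module on the generators. -/
def genX {K L : CochainComplex (ModuleCat.{u} k) ℤ} (φ : K ⟶ L) (n : ℤ) : ModuleCat.{u} k :=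
  ModuleCat.of k (Gen φ n →₀ k)

/-- The basis element of a generator. -/
def genE {K L : CochainComplex (ModuleCat.{u} k) ℤ} (φ : K ⟶ L) {n : ℤ} (p : Gen φ n) :
    genX φ n := (Finsupp.single p (1 : k) : Gen φ n →₀ k)

/-- Linear extension. -/
def genLift {K L : CochainComplex (ModuleCat.{u} k) ℤ} (φ : K ⟶ L) (n : ℤ) {A : ModuleCat.{u} k}
    (h : Gen φ n → A) : genX φ n ⟶ A :=
  ModuleCat.ofHom (X := Gen φ n →₀ k) (Finsupp.linearCombination k h)

lemma genLift_genE {K L : CochainComplex (ModuleCat.{u} k) ℤ} (φ : K ⟶ L) (n : ℤ)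
    {A : ModuleCat.{u} k} (h : Gen φ n → A) (p : Gen φ n) : genLift φ n h (genE φ p) = h p := by
  have : Finsupp.linearCombination k h (Finsupp.single p (1 : k)) = h p := by simp
  exact this

lemma genX_ext {K L : CochainComplex (ModuleCat.{u} k) ℤ} (φ : K ⟶ L) (n : ℤ)
    {A : ModuleCat.{u} k} {f g : genX φ n ⟶ A} (h : ∀ p, f (genE φ p) = g (genE φ p)) :
    f = g := by
  apply ModuleCat.hom_ext
  exact Finsupp.lhom_ext' (M := k) (fun p => LinearMap.ext_ring (h p))

/-- Free complex with zero differential on the generators. -/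
def genCx {K L : CochainComplex (ModuleCat.{u} k) ℤ} (φ : K ⟶ L) :
    CochainComplex (ModuleCat.{u} k) ℤ where
  X n := genX φ n
  d _ _ := 0

lemma genB_d {K L : CochainComplex (ModuleCat.{u} k) ℤ} (φ : K ⟶ L) (n : ℤ) :
    genLift φ n (fun p => p.b) ≫ K.d n (n + 1) = 0 := by
  apply genX_ext
  intro p
  rw [ConcreteCategory.comp_apply, genLift_genE, p.hb]
  rfl

/-- The attaching map. -/
def genMap {K L : CochainComplex (ModuleCat.{u} k) ℤ} (φ : K ⟶ L) : genCx φ ⟶ K where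
  f n := genLift φ n (fun p => p.b)
  comm' i j hij := by
    obtain rfl : i + 1 = j := hij
    exact (genB_d φ i).trans zero_comp.symm

/-- The null homotopy. -/
def genHtpy {K L : CochainComplex (ModuleCat.{u} k) ℤ} (φ : K ⟶ L) :
    Cochain (genCx φ) L (-1) :=
  Cochain.mk (fun p _ hpq => genLift φ p (fun p => p.y) ≫ (L.XIsoOfEq hpq).hom)

lemma genHtpy_v {K L : CochainComplex (ModuleCat.{u} k) ℤ} (φ : K ⟶ L) (n : ℤ) :
    (genHtpy φ).v n (n + -1) rfl = genLift φ n (fun p => p.y) := by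
  dsimp only [genHtpy]
  exact Category.comp_id _

lemma genHtpy_δ {K L : CochainComplex (ModuleCat.{u} k) ℤ} (φ : K ⟶ L) :
    δ (-1) 0 (genHtpy φ) = Cochain.ofHom (genMap φ ≫ φ) := by
  ext1 n
  rw [δ_v (-1) 0 (by simp) _ n n (by simp) (n + -1) (n + 1) (by lia) rfl]
  have : (genCx φ).d n (n + 1) = 0 := rfl
  rw [this, zero_comp, smul_zero, add_zero, Cochain.ofHom_v, genHtpy_v]
  apply genX_ext
  intro p
  have h1 := p.hy
  have h2 := genLift_genE φ n (fun p => p.y) p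
  have h3 := genLift_genE φ n (fun p => p.b) p
  refine (congrArg (L.d (n + -1) n) h2).trans (h1.trans ?_)
  exact (congrArg (φ.f n) h3).symm

lemma adjPart {B Y : 𝒞} (q : B ⟶ Y) {C : DGS k S} (i : U.obj B ⟶ C) (c : C ⟶ U.obj Y)
    (hc : i ≫ c = U.map q) :
    ∃ (E : 𝒞) (j : B ⟶ E) (g : F.obj C ⟶ E) (q' : E ⟶ Y) (w : C ⟶ U.obj E),
      IsPushout (adj.counit.app B) (F.map i) j g ∧ j ≫ q' = q ∧ i ≫ w = U.map j ∧
      w ≫ U.map q' = c := by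
  let c' : F.obj C ⟶ Y := (adj.homEquiv _ _).symm c
  have hcomm : adj.counit.app B ≫ q = F.map i ≫ c' := by
    rw [← Adjunction.homEquiv_naturality_left_symm, hc, Adjunction.homEquiv_counit]
    simp
  let j := pushout.inl (adj.counit.app B) (F.map i)
  let g := pushout.inr (adj.counit.app B) (F.map i)
  have hp : IsPushout (adj.counit.app B) (F.map i) j g := IsPushout.of_hasPushout _ _
  let q' := pushout.desc q c' hcomm
  have hg : g ≫ q' = c' := pushout.inr_desc _ _ _
  refine ⟨_, j, g, q', adj.unit.app _ ≫ U.map g, hp, pushout.inl_desc _ _ _, ?_, ?_⟩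
  · have := adj.unit.naturality i
    dsimp at this
    rw [reassoc_of% this, ← U.map_comp, ← hp.w, U.map_comp]
    simp
  · rw [Category.assoc, ← U.map_comp, hg, ← Adjunction.homEquiv_unit]
    simp [c']

lemma cxPart {K L E : CochainComplex (ModuleCat.{u} k) ℤ} (φ : K ⟶ L) (j : K ⟶ E) (q' : E ⟶ L)
    (w : mappingCone (genMap φ) ⟶ E) (hw1 : mappingCone.inr (genMap φ) ≫ w = j)
    (hw2 : w ≫ q' = mappingCone.desc (genMap φ) (genHtpy φ) φ (genHtpy_δ φ))
    (m n l : ℤ) (hm : m + 1 = n) (hl : n + 1 = l) (b : K.X n) (y : L.X m)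
    (hb : K.d n l b = 0) (hy : L.d m n y = φ.f n b) :
    ∃ t : E.X m, E.d m n t = j.f n b ∧ q'.f m t = y := by
  obtain rfl : m = n + -1 := by lia
  subst hl
  let p : Gen φ n := ⟨b, y, hb, hy⟩
  let e : (genCx φ).X n := genE φ p
  have h1 : (mappingCone.inl (genMap φ)).v n (n + -1) rfl ≫
      (mappingCone (genMap φ)).d (n + -1) n =
        (genMap φ).f n ≫ (mappingCone.inr (genMap φ)).f n := by
    rw [mappingCone.inl_v_d (genMap φ) n (n + -1) (n + 1) rfl (by lia)]
    have h0 : (genCx φ).d n (n + 1) = 0 := rfl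
    rw [h0, zero_comp, sub_zero]
  have hae : (genMap φ).f n e = b := genLift_genE φ n (fun p => p.b) p
  have hye : (genHtpy φ).v n (n + -1) rfl e = y := by
    rw [genHtpy_v]
    exact genLift_genE φ n (fun p => p.y) p
  refine ⟨((mappingCone.inl (genMap φ)).v n (n + -1) rfl ≫ w.f (n + -1)) e, ?_, ?_⟩
  · rw [← ConcreteCategory.comp_apply, Category.assoc, w.comm, reassoc_of% h1,
      ← HomologicalComplex.comp_f, hw1, ConcreteCategory.comp_apply, hae]
  · rw [← ConcreteCategory.comp_apply, Category.assoc, ← HomologicalComplex.comp_f, hw2,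
      mappingCone.inl_v_desc_f, hye]

lemma step {B Y : 𝒞} (q : B ⟶ Y) :
    ∃ (E : 𝒞) (j : B ⟶ E) (q' : E ⟶ Y), j ≫ q' = q ∧ IsElemStdCof F U adj j ∧
      ∀ (x : S) (m n l : ℤ) (_ : m + 1 = n) (_ : n + 1 = l) (b : (U.obj B x).X n)
        (y : (U.obj Y x).X m),
        (U.obj B x).d n l b = 0 → (U.obj Y x).d m n y = (U.map q x).f n b →
        ∃ t : (U.obj E x).X m, (U.obj E x).d m n t = (U.map j x).f n b ∧
          (U.map q' x).f m t = y := by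
  let M : DGS k S := fun x => genCx (U.map q x)
  let α : M ⟶ U.obj B := fun x => genMap (U.map q x)
  let c : DGS.coneFun α ⟶ U.obj Y := fun x =>
    mappingCone.desc (α x) (genHtpy (U.map q x)) (U.map q x) (genHtpy_δ _)
  have hc : DGS.coneInr α ≫ c = U.map q := by
    funext x
    exact mappingCone.inr_desc _ _ _ _
  obtain ⟨E, j, g, q', w, hp, hq, hw1, hw2⟩ := adjPart F U adj q (DGS.coneInr α) c hc
  refine ⟨E, j, q', hq, ⟨M, α, g, ⟨fun _ _ _ => rfl, fun x n => ?_⟩, hp⟩, ?_⟩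
  · exact inferInstanceAs (Module.Free k (Gen (U.map q x) n →₀ k))
  · intro x
    exact cxPart (U.map q x) (U.map j x) (U.map q' x) (w x) (congrFun hw1 x) (congrFun hw2 x)

lemma trivFib {K L : CochainComplex (ModuleCat.{u} k) ℤ} (φ : K ⟶ L)
    (h : ∀ (m n l : ℤ) (_ : m + 1 = n) (_ : n + 1 = l) (b : K.X n) (y : L.X m),
        K.d n l b = 0 → L.d m n y = φ.f n b →
        ∃ t : K.X m, K.d m n t = b ∧ φ.f m t = y) :
    (∀ m, Function.Surjective (φ.f m)) ∧ QuasiIso φ := by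
  have hz : ∀ (m n : ℤ) (_ : m + 1 = n) (y : L.X m), L.d m n y = 0 →
      ∃ t : K.X m, K.d m n t = 0 ∧ φ.f m t = y := by
    intro m n hm y hy
    obtain ⟨t, h1, h2⟩ := h m n (n + 1) hm rfl 0 y (by simp) (by simp [hy])
    exact ⟨t, h1, h2⟩
  refine ⟨fun m y => ?_, ⟨fun n => ?_⟩⟩
  · obtain ⟨b, h1, h2⟩ := hz (m + 1) (m + 1 + 1) rfl (L.d m (m + 1) y)
      (by simp [← ConcreteCategory.comp_apply])
    obtain ⟨t, h3, h4⟩ := h m (m + 1) (m + 1 + 1) rfl rfl b y h1 h2.symm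
    exact ⟨t, h4⟩
  · rw [quasiIsoAt_iff_isIso_homologyMap]
    have epi_free : ∀ A : ModuleCat.{u} k, Epi
        (ModuleCat.ofHom (Finsupp.linearCombination k (fun a : A => a)) :
          ModuleCat.of k (A →₀ k) ⟶ A) := by
      intro A
      rw [ModuleCat.epi_iff_surjective]
      intro a
      exact ⟨Finsupp.single a 1, by simp⟩
    have h1 : Mono (HomologicalComplex.homologyMap φ n) := by
      rw [HomologicalComplex.mono_homologyMap_iff_up_to_refinements φ (n - 1) n (n + 1)
        (by simp) (by simp)]
      intro A x₂ hx₂ y₁ hy₁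
      have key : ∀ a : A, ∃ t : K.X (n - 1), K.d (n - 1) n t = x₂ a := by
        intro a
        obtain ⟨t, ht, -⟩ := h (n - 1) n (n + 1) (by lia) rfl (x₂ a) (y₁ a)
          (ConcreteCategory.congr_hom hx₂ a) (ConcreteCategory.congr_hom hy₁ a).symm
        exact ⟨t, ht⟩
      choose t ht using key
      refine ⟨_, _, epi_free A, ModuleCat.ofHom (Finsupp.linearCombination k t), ?_⟩
      ext a
      simp [ht]
    have h2 : Epi (HomologicalComplex.homologyMap φ n) := by
      rw [HomologicalComplex.epi_homologyMap_iff_up_to_refinements φ (n - 1) n (n + 1)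
        (by simp) (by simp)]
      intro A y₂ hy₂
      have key : ∀ a : A, ∃ t : K.X n, K.d n (n + 1) t = 0 ∧ φ.f n t = y₂ a := fun a =>
        hz n (n + 1) rfl (y₂ a) (ConcreteCategory.congr_hom hy₂ a)
      choose t ht ht' using key
      refine ⟨_, _, epi_free A, ModuleCat.ofHom (Finsupp.linearCombination k t), ?_, 0, ?_⟩
      · ext a
        simp [ht]
      · ext a
        simp [ht']
    exact isIso_of_mono_of_epi _

/-- Evaluation of a colimit cocone in a product category is a colimit. -/
lemma eval_isColimit {J : Type} [SmallCategory J] (G : J ⥤ DGS k S) (c : Cocone G)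
    (hc : IsColimit c) (x : S) : Nonempty (IsColimit ((Pi.eval _ x).mapCocone c)) := by
  let c' : ∀ y : S, Cocone (G ⋙ Pi.eval _ y) := fun y => colimit.cocone _
  let c₀ : Cocone G :=
    { pt := fun y => (c' y).pt
      ι := { app := fun j y => (c' y).ι.app j
             naturality := fun _ _ f => funext fun y => (c' y).ι.naturality f } }
  let ev : ∀ (s : Cocone G) (y : S), Cocone (G ⋙ Pi.eval _ y) := fun s y =>
    { pt := s.pt y
      ι := { app := fun j => s.ι.app j y
             naturality := fun _ _ f => congrFun (s.ι.naturality f) y } }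
  have hc' : IsColimit c₀ :=
    { desc := fun s y => (colimit.isColimit (G ⋙ Pi.eval _ y)).desc (ev s y)
      fac := fun s j => funext fun y => (colimit.isColimit (G ⋙ Pi.eval _ y)).fac (ev s y) j
      uniq := fun s m hm => funext fun y =>
        (colimit.isColimit (G ⋙ Pi.eval _ y)).uniq (ev s y) (m y)
          (fun j => congrFun (hm j) y) }
  have i := hc'.uniqueUpToIso hc
  have i' : c' x ≅ (Pi.eval _ x).mapCocone c :=
    (Cocone.functoriality G (Pi.eval _ x)).mapIso i
  exact ⟨(colimit.isColimit _).ofIsoColimit i'⟩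

lemma colimPart [PreservesFilteredColimits U] {Y : 𝒞} (Dseq : ℕ ⥤ 𝒞)
    (q : Dseq ⟶ (Functor.const ℕ).obj Y)
    (hlift : ∀ (j : ℕ) (x : S) (m n l : ℤ) (_ : m + 1 = n) (_ : n + 1 = l)
        (b : (U.obj (Dseq.obj j) x).X n) (y : (U.obj Y x).X m),
        (U.obj (Dseq.obj j) x).d n l b = 0 →
        (U.obj Y x).d m n y = (U.map (q.app j) x).f n b →
        ∃ t : (U.obj (Dseq.obj (j + 1)) x).X m, (U.obj (Dseq.obj (j + 1)) x).d m n t =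
          (U.map (Dseq.map (homOfLE (Nat.le_succ j))) x).f n b ∧
          (U.map (q.app (j + 1)) x).f m t = y) (x : S) :
    (∀ m, Function.Surjective ((U.map (colimit.desc Dseq ⟨Y, q⟩) x).f m)) ∧
      QuasiIso (U.map (colimit.desc Dseq ⟨Y, q⟩) x) := by
  have := preservesSmallestFilteredColimits_of_preservesFilteredColimits U
  have hU : IsColimit (U.mapCocone (colimit.cocone Dseq)) :=
    isColimitOfPreserves U (colimit.isColimit Dseq)
  exact
    FactAux.trivFib (U.map (colimit.desc Dseq ⟨Y, q⟩) x) (by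
      obtain ⟨hx⟩ := FactAux.eval_isColimit _ _ hU x
      have hx' := fun n : ℤ => isColimitOfPreserves (HomologicalComplex.eval _ _ n) hx
      have hfor := preservesSmallestFilteredColimits_of_preservesFilteredColimits
        (forget (ModuleCat.{u} k))
      intro m n l hm hl b y hb hy
      let ι : ∀ i, U.obj (Dseq.obj i) x ⟶ U.obj (colimit Dseq) x := fun i =>
        U.map (colimit.ι Dseq i) x
      let tr : ∀ {i j : ℕ} (a : i ⟶ j), U.obj (Dseq.obj i) x ⟶ U.obj (Dseq.obj j) x := fun a =>
        U.map (Dseq.map a) x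
      have hι : ∀ {i j : ℕ} (a : i ⟶ j), tr a ≫ ι j = ι i := fun {i j} a => by
        change (U.map (Dseq.map a) ≫ U.map (colimit.ι Dseq j)) x = _
        rw [← U.map_comp, colimit.w]
      have hιq : ∀ i, ι i ≫ U.map (colimit.desc Dseq ⟨Y, q⟩) x = U.map (q.app i) x := fun i => by
        change (U.map (colimit.ι Dseq i) ≫ U.map (colimit.desc Dseq ⟨Y, q⟩)) x = _
        rw [← U.map_comp, colimit.ι_desc]
      obtain ⟨i, b0, hb0⟩ : ∃ (i : ℕ) (b0 : (U.obj (Dseq.obj i) x).X n), (ι i).f n b0 = b :=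
        Concrete.isColimit_exists_rep _ (hx' n) b
      obtain ⟨j, a, a', hd⟩ : ∃ (j : ℕ) (a a' : i ⟶ j),
          (tr a).f l ((U.obj (Dseq.obj i) x).d n l b0) = (tr a').f l 0 := by
        refine Concrete.isColimit_exists_of_rep_eq _ (hx' l) _ _ ?_
        change (ι i).f l ((U.obj (Dseq.obj i) x).d n l b0) = (ι i).f l 0
        have e := ConcreteCategory.congr_hom ((ι i).comm n l) b0
        rw [ConcreteCategory.comp_apply, ConcreteCategory.comp_apply, hb0, hb] at e
        rw [map_zero, ← e]
      rw [map_zero, ← ConcreteCategory.comp_apply, ← (tr a).comm,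
        ConcreteCategory.comp_apply] at hd
      have hb1 : (ι j).f n ((tr a).f n b0) = b := by
        rw [← hb0, ← hι a]
        rfl
      generalize (tr a).f n b0 = b1 at hd hb1
      obtain ⟨t, ht1, ht2⟩ := hlift j x m n l hm hl b1 y hd (by
        rw [hy, ← hb1, ← ConcreteCategory.comp_apply, ← HomologicalComplex.comp_f, hιq])
      refine ⟨(ι (j + 1)).f m t, ?_, ?_⟩
      · rw [← ConcreteCategory.comp_apply, (ι (j + 1)).comm, ConcreteCategory.comp_apply, ht1,
          ← hb1, ← hι (homOfLE (Nat.le_succ j))]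
        rfl
      · rw [← ConcreteCategory.comp_apply, ← HomologicalComplex.comp_f, hιq]
        exact ht2)

end FactAux

section

/-- (MC5)(i): assuming `U` preserves filtered colimits, every `f : X ⟶ Y` factors
through the colimit of a sequence `X = D₀ ⟶ D₁ ⟶ D₂ ⟶ ⋯` of elementary standard
cofibrations, compatible with morphisms `qₙ : Dₙ ⟶ Y`, `q₀ = f`, such that the induced
morphism `q : colimₙ Dₙ ⟶ Y` is a fibration and a weak equivalence. -/
theorem factorization_stdCof_trivFib [PreservesFilteredColimits U]
    {X Y : 𝒞} (f : X ⟶ Y) :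
    ∃ (Dseq : ℕ ⥤ 𝒞) (e : X ≅ Dseq.obj 0) (q : Dseq ⟶ (Functor.const ℕ).obj Y),
      e.hom ≫ q.app 0 = f ∧
      (∀ n : ℕ, IsElemStdCof F U adj (Dseq.map (homOfLE (Nat.le_succ n)))) ∧
      (∀ (x : S) (m : ℤ),
        Function.Surjective (((U.map (colimit.desc Dseq ⟨Y, q⟩)) x).f m)) ∧
      (∀ x : S, QuasiIso ((U.map (colimit.desc Dseq ⟨Y, q⟩)) x)) := by
  classical
  choose st sj sq h1 h2 h3 using fun (B : 𝒞) (q : B ⟶ Y) => FactAux.step F U adj q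
  let ob : ℕ → Over Y := fun n =>
    Nat.rec (Over.mk f) (fun _ A => Over.mk (sq A.left A.hom)) n
  let mp : ∀ n, ob n ⟶ ob (n + 1) := fun n =>
    Over.homMk (sj (ob n).left (ob n).hom) (h1 _ _)
  let W : ℕ ⥤ Over Y := Functor.ofSequence mp
  have hW : ∀ n, W.map (homOfLE (Nat.le_succ n)) = mp n :=
    fun n => Functor.ofSequence_map_homOfLE_succ mp n
  let Dseq : ℕ ⥤ 𝒞 := W ⋙ Over.forget Y
  have hD : ∀ n, Dseq.map (homOfLE (Nat.le_succ n)) = sj (ob n).left (ob n).hom := fun n => by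
    change (W.map (homOfLE (Nat.le_succ n))).left = _
    rw [hW]
    rfl
  let q : Dseq ⟶ (Functor.const ℕ).obj Y :=
    { app := fun n => (W.obj n).hom
      naturality := fun i j φ => by
        simp [Dseq] }
  have main := FactAux.colimPart U Dseq q (fun j x m n l hm hl b y hb hy => by
    rw [hD]
    exact h3 (ob j).left (ob j).hom x m n l hm hl b y hb hy)
  refine ⟨Dseq, Iso.refl _, q, Category.id_comp _, fun n => ?_, fun x => (main x).1,
    fun x => (main x).2⟩
  rw [hD]
  exact h2 _ _

end
end
end
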